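/- arXiv:1607.03865 — 7 statements merged into one kernel-verified Lean document; each statement's English description precedes it below -/
import Mathlib

section
/- For every permutation σ ∈ S_r, the set N^c_{λ,σ} is a subgroup of GL(r,ℂ): it contains the identity matrix, is closed under matrix multiplication, and is closed under matrix inversion. -/
open Finset Matrix

/-- Partial sums of the sequence of parts `i 0, i 1, …`. -/
def psum (i : ℕ → ℕ) (l : ℕ) : ℕ := ∑ t ∈ Finset.range l, i t

/-- The (0-indexed) block index of position `j ∈ {0,…,r-1}` with respect to the partition
with parts `i 0, …, i (s-1)`. -/
def blk (s : ℕ) (i : ℕ → ℕ) (j : ℕ) : ℕ :=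
  ((Finset.range s).filter fun l => psum i (l + 1) ≤ j).card

/-- `N(r)`: complex lower triangular `r × r` matrices with all diagonal entries `1`. -/
def NN (r : ℕ) : Set (Matrix (Fin r) (Fin r) ℂ) :=
  {U | (∀ j, U j j = 1) ∧ ∀ j k : Fin r, (j : ℕ) < (k : ℕ) → U j k = 0}

/-- `B(r)`: invertible lower triangular complex matrices. -/
def BB (r : ℕ) : Set (Matrix (Fin r) (Fin r) ℂ) :=
  {g | IsUnit g ∧ ∀ j k : Fin r, (j : ℕ) < (k : ℕ) → g j k = 0}

/-- `N_{λ,σ}`: matrices `U ∈ N(r)` with `U j k = 0` whenever `j > k` and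
`b(σ j) < b(σ k)`. -/
def Nlam (r s : ℕ) (i : ℕ → ℕ) (σ : Fin r → Fin r) : Set (Matrix (Fin r) (Fin r) ℂ) :=
  {U | U ∈ NN r ∧ ∀ j k : Fin r, (k : ℕ) < (j : ℕ) →
    blk s i (σ j) < blk s i (σ k) → U j k = 0}

/-- `N^c_{λ,σ}`: matrices `U ∈ N(r)` with `U j k = 0` whenever `j > k` and
`b(σ j) ≥ b(σ k)`. -/
def Nc (r s : ℕ) (i : ℕ → ℕ) (σ : Fin r → Fin r) : Set (Matrix (Fin r) (Fin r) ℂ) :=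
  {U | U ∈ NN r ∧ ∀ j k : Fin r, (k : ℕ) < (j : ℕ) →
    blk s i (σ k) ≤ blk s i (σ j) → U j k = 0}

/-- The parabolic subgroup `P_λ`: invertible matrices `g` with `g j k = 0` whenever
`b(j) < b(k)`. -/
def Plam (r s : ℕ) (i : ℕ → ℕ) : Set (Matrix (Fin r) (Fin r) ℂ) :=
  {g | IsUnit g ∧ ∀ j k : Fin r, blk s i (j : ℕ) < blk s i (k : ℕ) → g j k = 0}

/-- The Levi subgroup `D_λ`: invertible matrices `g` with `g j k = 0` whenever
`b(j) ≠ b(k)`. -/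
def Dlam (r s : ℕ) (i : ℕ → ℕ) : Set (Matrix (Fin r) (Fin r) ℂ) :=
  {g | IsUnit g ∧ ∀ j k : Fin r, blk s i (j : ℕ) ≠ blk s i (k : ℕ) → g j k = 0}

/-- The permutation matrix `Π_σ`, with `(Π_σ)_{jk} = 1` iff `k = σ j`. -/
def permMat (r : ℕ) (σ : Fin r → Fin r) : Matrix (Fin r) (Fin r) ℂ :=
  Matrix.of fun j k => if σ j = k then 1 else 0

/-- The single-block unipotent group `U_l` (here `a = i_1 + ⋯ + i_l`): matrices in `N(r)`
whose strictly-lower entries vanish except possibly in the lower-left block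
`j > a ≥ k` (1-indexed), i.e. `a ≤ j ∧ k < a` (0-indexed). -/
def Ublock (r a : ℕ) : Set (Matrix (Fin r) (Fin r) ℂ) :=
  {U | U ∈ NN r ∧ ∀ j k : Fin r, (k : ℕ) < (j : ℕ) →
    ¬(a ≤ (j : ℕ) ∧ (k : ℕ) < a) → U j k = 0}

section StrictOrderPattern

variable {n α : Type*} [CommRing α]

/-- `U` has diagonal entries `1`, and its off-diagonal entries vanish outside the relation `R`. -/
def IsUnipotentAlong (R : n → n → Prop) (U : Matrix n n α) : Prop :=
  (∀ j, U j j = 1) ∧ ∀ j k, j ≠ k → ¬ R j k → U j k = 0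

variable {R : n → n → Prop} {U V : Matrix n n α}

theorem IsUnipotentAlong.one [DecidableEq n] :
    IsUnipotentAlong R (1 : Matrix n n α) :=
  ⟨fun _ => Matrix.one_apply_eq _, fun _ _ h _ => Matrix.one_apply_ne h⟩

theorem IsUnipotentAlong.mul [Fintype n] [IsStrictOrder n R]
    (hU : IsUnipotentAlong R U) (hV : IsUnipotentAlong R V) :
    IsUnipotentAlong R (U * V) := by
  refine ⟨fun j => ?_, fun j k hjk hR => ?_⟩
  · rw [Matrix.mul_apply, Fintype.sum_eq_single j, hU.1, hV.1, one_mul]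
    intro l hl
    by_cases h : R j l
    · rw [hV.2 l j hl (asymm h), mul_zero]
    · rw [hU.2 j l hl.symm h, zero_mul]
  · rw [Matrix.mul_apply]
    refine Finset.sum_eq_zero fun l _ => ?_
    by_cases h : R j l
    · rw [hV.2 l k (by rintro rfl; exact hR h) fun h' => hR (_root_.trans h h'), mul_zero]
    · rcases eq_or_ne j l with rfl | hjl
      · rw [hV.2 j k hjk hR, mul_zero]
      · rw [hU.2 j l hjl h, zero_mul]

theorem IsUnipotentAlong.of_mul_eq_one [Fintype n] [DecidableEq n] [IsStrictOrder n R]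
    (hU : IsUnipotentAlong R U) (hUV : U * V = 1) : IsUnipotentAlong R V := by
  have expand (j k : n) (h : ∀ l, R j l → V l k = 0) : V j k = (1 : Matrix n n α) j k := by
    rw [← hUV, Matrix.mul_apply, Fintype.sum_eq_single j, hU.1, one_mul]
    intro l hl
    by_cases hjl : R j l
    · rw [h l hjl, mul_zero]
    · rw [hU.2 j l hl.symm hjl, zero_mul]
  have off (j : n) : ∀ k, j ≠ k → ¬ R j k → V j k = 0 := by
    induction j using (Finite.wellFounded_of_trans_of_irrefl (Function.swap R)).induction with
    | _ j ih =>
      intro k hjk hR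
      rw [expand j k, Matrix.one_apply_ne hjk]
      intro l hl
      exact ih l hl k (by rintro rfl; exact hR hl) fun h' => hR (_root_.trans hl h')
  refine ⟨fun j => ?_, off⟩
  rw [expand j j, Matrix.one_apply_eq]
  intro l hl
  exact off l j (by rintro rfl; exact irrefl _ hl) (asymm hl)

theorem IsUnipotentAlong.inv [Fintype n] [LinearOrder n] [IsStrictOrder n R]
    (hR : ∀ j k, R j k → k < j) (hU : IsUnipotentAlong R U) : IsUnipotentAlong R U⁻¹ := by
  have hdet : U.det = 1 := by
    rw [Matrix.det_of_isLowerTriangular U, Finset.prod_eq_one fun j _ => hU.1 j]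
    intro j k hjk
    have hlt : j < k := hjk
    exact hU.2 j k hlt.ne fun h => lt_asymm hlt (hR j k h)
  exact hU.of_mul_eq_one (Matrix.mul_nonsing_inv U (by simp [hdet]))

end StrictOrderPattern

/-- The positions below the diagonal at which matrices in `Nc` are unconstrained. -/
def NcRel (r s : ℕ) (i : ℕ → ℕ) (σ : Fin r → Fin r) (j k : Fin r) : Prop :=
  k < j ∧ blk s i (σ j) < blk s i (σ k)

instance (r s : ℕ) (i : ℕ → ℕ) (σ : Fin r → Fin r) : IsStrictOrder (Fin r) (NcRel r s i σ) where
  irrefl _ h := lt_irrefl _ h.1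
  trans _ _ _ h h' := ⟨h'.1.trans h.1, h.2.trans h'.2⟩

theorem mem_Nc_iff {r s : ℕ} {i : ℕ → ℕ} {σ : Fin r → Fin r} {U : Matrix (Fin r) (Fin r) ℂ} :
    U ∈ Nc r s i σ ↔ IsUnipotentAlong (NcRel r s i σ) U := by
  constructor
  · rintro ⟨⟨hdiag, hupper⟩, hlower⟩
    refine ⟨hdiag, fun j k hjk hR => ?_⟩
    rcases lt_or_gt_of_ne hjk with h | h
    · exact hupper j k h
    · exact hlower j k h (not_lt.mp fun hb => hR ⟨h, hb⟩)
  · rintro ⟨hdiag, hoff⟩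
    exact ⟨⟨hdiag, fun j k h => hoff j k (Fin.ne_of_lt h) fun hR => lt_asymm h hR.1⟩,
      fun j k h hb => hoff j k (Fin.ne_of_gt h) fun hR => hR.2.not_ge hb⟩

/-- For every permutation `σ ∈ S_r`, the set `N^c_{λ,σ}` is a subgroup of
`GL(r,ℂ)`: it contains the identity matrix, is closed under matrix multiplication, and is
closed under matrix inversion. -/
theorem Nc_is_subgroup (r s : ℕ) (i : ℕ → ℕ) (hr : 2 ≤ r)
    (hpos : ∀ l < s, 0 < i l) (hsum : psum i s = r) (σ : Equiv.Perm (Fin r)) :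
    (1 : Matrix (Fin r) (Fin r) ℂ) ∈ Nc r s i ⇑σ ∧
    (∀ U V : Matrix (Fin r) (Fin r) ℂ,
      U ∈ Nc r s i ⇑σ → V ∈ Nc r s i ⇑σ → U * V ∈ Nc r s i ⇑σ) ∧
    (∀ U : Matrix (Fin r) (Fin r) ℂ, U ∈ Nc r s i ⇑σ → U⁻¹ ∈ Nc r s i ⇑σ) := by
  simp only [mem_Nc_iff]
  exact ⟨.one, fun _ _ hU hV => hU.mul hV, fun _ hU => hU.inv fun _ _ h => h.1⟩
end

section
/- For every permutation σ ∈ S_r, every matrix C ∈ N(r) can be written as C = A·B with A ∈ N^c_{λ,σ} and B ∈ N_{λ,σ}, this factorization is unique, and moreover N^c_{λ,σ} ∩ N_{λ,σ} = {Id}. -/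
open Finset Matrix

/-- The product of two lower unitriangular matrices, strictly below the diagonal. -/
theorem mul_apply_of_mem_NN {r : ℕ} {A B : Matrix (Fin r) (Fin r) ℂ} (hA : A ∈ NN r)
    (hB : B ∈ NN r) {j k : Fin r} (hkj : k < j) :
    (A * B) j k = A j k + B j k + ∑ m ∈ Finset.Ioo k j, A j m * B m k := by
  have hIcc : Finset.Icc k j = insert k (insert j (Finset.Ioo k j)) := by
    ext m
    simp only [Finset.mem_Icc, Finset.mem_insert, Finset.mem_Ioo]
    lia
  have hsum : ∑ m ∈ Finset.Icc k j, A j m * B m k = ∑ m, A j m * B m k := by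
    refine Finset.sum_subset (Finset.subset_univ _) fun m _ hm => ?_
    rw [Finset.mem_Icc, not_and_or, not_le, not_le] at hm
    rcases hm with hm | hm
    · rw [hB.2 m k hm, mul_zero]
    · rw [hA.2 j m hm, zero_mul]
  rw [Matrix.mul_apply, ← hsum, hIcc, Finset.sum_insert (by simp [hkj.ne]),
    Finset.sum_insert (by simp), hB.1, hA.1]
  ring

/-- A product of lower unitriangular matrices is lower unitriangular. -/
theorem mul_mem_NN {r : ℕ} {A B : Matrix (Fin r) (Fin r) ℂ} (hA : A ∈ NN r)
    (hB : B ∈ NN r) : A * B ∈ NN r := by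
  refine ⟨fun j => ?_, fun j k hjk => ?_⟩
  · rw [Matrix.mul_apply, Finset.sum_eq_single j, hA.1, hB.1, mul_one]
    · intro m _ hm
      rcases lt_or_gt_of_ne hm with h | h
      · rw [hB.2 m j h, mul_zero]
      · rw [hA.2 j m h, zero_mul]
    · simp
  · rw [Matrix.mul_apply]
    refine Finset.sum_eq_zero fun m _ => ?_
    rcases lt_or_ge j m with h | h
    · rw [hA.2 j m h, zero_mul]
    · rw [hB.2 m k (lt_of_le_of_lt h hjk), mul_zero]

/-- Lower unitriangular matrices agreeing strictly below the diagonal are equal. -/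
theorem eq_of_mem_NN {r : ℕ} {A B : Matrix (Fin r) (Fin r) ℂ} (hA : A ∈ NN r)
    (hB : B ∈ NN r) (h : ∀ j k : Fin r, k < j → A j k = B j k) : A = B := by
  ext j k
  rcases lt_trichotomy j k with hjk | rfl | hjk
  · rw [hA.2 j k hjk, hB.2 j k hjk]
  · rw [hA.1, hB.1]
  · exact h j k hjk

theorem one_mem_NN (r : ℕ) : (1 : Matrix (Fin r) (Fin r) ℂ) ∈ NN r :=
  ⟨fun j => Matrix.one_apply_eq j, fun _ _ hjk => Matrix.one_apply_ne (Fin.ne_of_lt hjk)⟩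

/-- The strictly lower entries of both factors in the factorization of `C`: the entry at
`(j, k)` belongs to the first factor if `f j < f k` and to the second one otherwise. -/
noncomputable def factorEntry {r : ℕ} (f : Fin r → ℕ) (C : Matrix (Fin r) (Fin r) ℂ)
    (j k : Fin r) : ℂ :=
  C j k - ∑ m : Fin r, if _h : k < m ∧ m < j then
    (if f j < f m then factorEntry f C j m else 0) *
      (if f m < f k then 0 else factorEntry f C m k) else 0
termination_by (j : ℕ) - (k : ℕ)
decreasing_by all_goals lia

/-- The lower unitriangular matrix with the entries of `E` at the positions in `p`, and zeros
elsewhere below the diagonal. -/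
noncomputable def unitri {r : ℕ} (p : Fin r → Fin r → Prop) (E : Fin r → Fin r → ℂ) :
    Matrix (Fin r) (Fin r) ℂ :=
  open Classical in
  Matrix.of fun j k => if j = k then 1 else if k < j ∧ p j k then E j k else 0

theorem unitri_mem_NN {r : ℕ} (p : Fin r → Fin r → Prop) (E : Fin r → Fin r → ℂ) :
    unitri p E ∈ NN r := by
  refine ⟨fun j => by simp [unitri], fun j k hjk => ?_⟩
  have hjk' : j < k := hjk
  simp [unitri, hjk'.ne, hjk'.not_gt]

open Classical in
theorem unitri_apply {r : ℕ} (p : Fin r → Fin r → Prop) (E : Fin r → Fin r → ℂ)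
    {j k : Fin r} (hkj : k < j) : unitri p E j k = if p j k then E j k else 0 := by
  simp [unitri, hkj, hkj.ne']

/-- Every lower unitriangular matrix factors according to `f`. -/
theorem eq_unitri_mul_unitri {r : ℕ} (f : Fin r → ℕ) {C : Matrix (Fin r) (Fin r) ℂ}
    (hC : C ∈ NN r) :
    C = unitri (fun j k => f j < f k) (factorEntry f C) *
      unitri (fun j k => ¬ f j < f k) (factorEntry f C) := by
  have hA := unitri_mem_NN (fun j k => f j < f k) (factorEntry f C)
  have hB := unitri_mem_NN (fun j k => ¬ f j < f k) (factorEntry f C)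
  refine eq_of_mem_NN hC (mul_mem_NN hA hB) fun j k hkj => ?_
  have hsplit : unitri (fun j k => f j < f k) (factorEntry f C) j k +
      unitri (fun j k => ¬ f j < f k) (factorEntry f C) j k = factorEntry f C j k := by
    rw [unitri_apply _ _ hkj, unitri_apply _ _ hkj]
    by_cases h : f j < f k <;> simp [h]
  rw [mul_apply_of_mem_NN hA hB hkj, hsplit, factorEntry, eq_comm, sub_add_eq_add_sub,
    sub_eq_iff_eq_add, add_right_inj, ← Finset.sum_subset (Finset.subset_univ (Finset.Ioo k j))]
  · refine Finset.sum_congr rfl fun m hm => ?_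
    rw [Finset.mem_Ioo] at hm
    rw [dif_pos hm, unitri_apply _ _ hm.1, unitri_apply _ _ hm.2]
    by_cases h : f m < f k <;> simp [h]
  · intro m _ hm
    rw [Finset.mem_Ioo] at hm
    rw [dif_neg hm]

/-- The factorization is unique. -/
theorem eq_and_eq_of_mul_eq_mul {r : ℕ} {p : Fin r → Fin r → Prop}
    {A A' B B' : Matrix (Fin r) (Fin r) ℂ}
    (hA : A ∈ NN r) (hA' : A' ∈ NN r) (hB : B ∈ NN r) (hB' : B' ∈ NN r)
    (hAp : ∀ j k : Fin r, k < j → ¬ p j k → A j k = 0)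
    (hAp' : ∀ j k : Fin r, k < j → ¬ p j k → A' j k = 0)
    (hBp : ∀ j k : Fin r, k < j → p j k → B j k = 0)
    (hBp' : ∀ j k : Fin r, k < j → p j k → B' j k = 0)
    (h : A * B = A' * B') : A = A' ∧ B = B' := by
  have key : ∀ d : ℕ, ∀ j k : Fin r, k < j → (j : ℕ) - k = d →
      A j k = A' j k ∧ B j k = B' j k := by
    intro d
    induction d using Nat.strong_induction_on with
    | _ d ih =>
      intro j k hkj hd
      have hjk := congrFun (congrFun h j) k
      have hsum : ∑ m ∈ Finset.Ioo k j, A j m * B m k =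
          ∑ m ∈ Finset.Ioo k j, A' j m * B' m k := by
        refine Finset.sum_congr rfl fun m hm => ?_
        obtain ⟨hkm, hmj⟩ := Finset.mem_Ioo.mp hm
        rw [(ih _ (by lia) j m hmj rfl).1, (ih _ (by lia) m k hkm rfl).2]
      rw [mul_apply_of_mem_NN hA hB hkj, mul_apply_of_mem_NN hA' hB' hkj, hsum,
        add_left_inj] at hjk
      by_cases hp : p j k
      · have hBB : B j k = B' j k := by rw [hBp j k hkj hp, hBp' j k hkj hp]
        exact ⟨by rwa [hBB, add_left_inj] at hjk, hBB⟩
      · have hAA : A j k = A' j k := by rw [hAp j k hkj hp, hAp' j k hkj hp]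
        exact ⟨hAA, by rwa [hAA, add_right_inj] at hjk⟩
  exact ⟨eq_of_mem_NN hA hA' fun j k hkj => (key _ j k hkj rfl).1,
    eq_of_mem_NN hB hB' fun j k hkj => (key _ j k hkj rfl).2⟩

/-- For every permutation `σ ∈ S_r`, every matrix `C ∈ N(r)` can be written
as `C = A·B` with `A ∈ N^c_{λ,σ}` and `B ∈ N_{λ,σ}`, this factorization is unique, and
moreover `N^c_{λ,σ} ∩ N_{λ,σ} = {Id}`. -/
theorem Nc_Nlam_factorization (r s : ℕ) (i : ℕ → ℕ) (hr : 2 ≤ r)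
    (hpos : ∀ l < s, 0 < i l) (hsum : psum i s = r) (σ : Equiv.Perm (Fin r)) :
    (∀ C ∈ NN r, ∃ A ∈ Nc r s i ⇑σ, ∃ B ∈ Nlam r s i ⇑σ, C = A * B) ∧
    (∀ A A' B B' : Matrix (Fin r) (Fin r) ℂ,
      A ∈ Nc r s i ⇑σ → A' ∈ Nc r s i ⇑σ → B ∈ Nlam r s i ⇑σ → B' ∈ Nlam r s i ⇑σ →
      A * B = A' * B' → A = A' ∧ B = B') ∧
    Nc r s i ⇑σ ∩ Nlam r s i ⇑σ = {(1 : Matrix (Fin r) (Fin r) ℂ)} := by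
  refine ⟨fun C hC => ?_, fun A A' B B' hA hA' hB hB' h => ?_, ?_⟩
  · refine ⟨_, ⟨unitri_mem_NN _ _, fun j k hkj hf => ?_⟩,
      _, ⟨unitri_mem_NN _ _, fun j k hkj hf => ?_⟩,
      eq_unitri_mul_unitri (fun j => blk s i (σ j)) hC⟩
    · rw [unitri_apply _ _ hkj, if_neg (not_lt.mpr hf)]
    · rw [unitri_apply _ _ hkj, if_neg (not_not.mpr hf)]
  · exact eq_and_eq_of_mul_eq_mul (p := fun j k => blk s i (σ j) < blk s i (σ k))
      hA.1 hA'.1 hB.1 hB'.1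
      (fun j k hkj hp => hA.2 j k hkj (not_lt.mp hp))
      (fun j k hkj hp => hA'.2 j k hkj (not_lt.mp hp)) hB.2 hB'.2 h
  · refine Set.eq_singleton_iff_unique_mem.mpr ⟨⟨⟨one_mem_NN r, fun j k hkj _ => ?_⟩,
      ⟨one_mem_NN r, fun j k hkj _ => ?_⟩⟩, fun U hU => ?_⟩
    · exact Matrix.one_apply_ne (Fin.ne_of_gt hkj)
    · exact Matrix.one_apply_ne (Fin.ne_of_gt hkj)
    · refine eq_of_mem_NN hU.1.1 (one_mem_NN r) fun j k hkj => ?_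
      rw [Matrix.one_apply_ne hkj.ne']
      rcases lt_or_ge (blk s i (σ j)) (blk s i (σ k)) with h | h
      · exact hU.2.2 j k hkj h
      · exact hU.1.2 j k hkj h
end

section
/- Every matrix g ∈ GL(r,ℂ) admits a factorization g = L·Π_σ·P with σ ∈ S_r, L ∈ N^c_{λ,σ}, and P ∈ P_λ. -/
open Finset Matrix

/-- A matrix with nonzero determinant has a permutation of nonzero entries. -/
theorem exists_perm_forall_ne_zero {n K : Type*} [Fintype n] [DecidableEq n] [Field K]
    (A : Matrix n n K) (hA : A.det ≠ 0) : ∃ σ : Equiv.Perm n, ∀ j, A j (σ j) ≠ 0 := by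
  rw [← Matrix.det_transpose, Matrix.det_apply] at hA
  obtain ⟨σ, -, hσ⟩ := Finset.exists_ne_zero_of_sum_ne_zero hA
  refine ⟨σ, fun j hj => hσ ?_⟩
  rw [Finset.prod_eq_zero (Finset.mem_univ j) (by simpa using hj), smul_zero]

/-- Row reduction along a filtration: if each `g j` lies in `F (c j)` modulo the span of the
preceding vectors, then there are `M j ∈ F (c j)` such that `g j - M j` is a combination of those
preceding `M k` with `c j < c k`. -/
theorem exists_reduced_family {K V : Type*} [Field K] [AddCommGroup V] [Module K V] {r : ℕ}
    (F : ℕ → Submodule K V) (hF : Monotone F) (g : Fin r → V) (c : Fin r → ℕ)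
    (h : ∀ j, ∃ x ∈ F (c j), g j - x ∈ Submodule.span K (g '' Set.Iio j)) :
    ∃ M : Fin r → V, ∀ j, M j ∈ F (c j) ∧
      g j - M j ∈ Submodule.span K (M '' {k | k < j ∧ c j < c k}) := by
  suffices H : ∀ n : ℕ, ∃ M : Fin r → V, ∀ j : Fin r, (j : ℕ) < n → M j ∈ F (c j) ∧
      g j - M j ∈ Submodule.span K (M '' {k | k < j ∧ c j < c k}) by
    obtain ⟨M, hM⟩ := H r
    exact ⟨M, fun j => hM j j.2⟩
  intro n
  induction n with
  | zero => exact ⟨g, fun j hj => absurd hj (Nat.not_lt_zero _)⟩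
  | succ n ih =>
    obtain ⟨M, hM⟩ := ih
    by_cases hn : n < r
    swap
    · exact ⟨M, fun j _ => hM j (by omega)⟩
    let m : Fin r := ⟨n, hn⟩
    obtain ⟨x, hx, hgx⟩ := h m
    have hspan : Submodule.span K (g '' Set.Iio m) ≤
        Submodule.span K (M '' {k | k < m ∧ c k ≤ c m}) ⊔
          Submodule.span K (M '' {k | k < m ∧ c m < c k}) := by
      rw [← Submodule.span_union, ← Set.image_union, Submodule.span_le]
      rintro _ ⟨k, hk, rfl⟩
      have hk' : k < m := hk
      rw [SetLike.mem_coe, ← sub_add_cancel (g k) (M k)]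
      refine add_mem ?_ (Submodule.subset_span ⟨k, ?_, rfl⟩)
      · refine Submodule.span_mono (Set.image_mono ?_) (hM k hk').2
        rintro l ⟨hl, -⟩
        rcases le_or_gt (c l) (c m) with h1 | h1
        · exact Or.inl ⟨hl.trans hk', h1⟩
        · exact Or.inr ⟨hl.trans hk', h1⟩
      · rcases le_or_gt (c k) (c m) with h1 | h1
        · exact Or.inl ⟨hk', h1⟩
        · exact Or.inr ⟨hk', h1⟩
    obtain ⟨y, hy, z, hz, hyz⟩ := Submodule.mem_sup.mp (hspan hgx)
    have hyF : y ∈ F (c m) := by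
      refine Submodule.span_le.mpr ?_ hy
      rintro _ ⟨k, ⟨hk, hck⟩, rfl⟩
      exact hF hck (hM k hk).1
    have himage : ∀ j : Fin r, (j : ℕ) < n + 1 →
        Function.update M m (x + y) '' {k | k < j ∧ c j < c k} =
          M '' {k | k < j ∧ c j < c k} := by
      intro j hj
      refine Set.image_congr ?_
      rintro k ⟨hk, -⟩
      refine Function.update_of_ne ?_ _ _
      rintro rfl
      have : n < (j : ℕ) := hk
      omega
    refine ⟨Function.update M m (x + y), fun j hj => ?_⟩
    rw [himage j hj]
    rcases eq_or_ne j m with rfl | hjm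
    · rw [Function.update_self]
      refine ⟨add_mem hx hyF, ?_⟩
      rwa [← sub_sub, ← hyz, add_sub_cancel_left]
    · rw [Function.update_of_ne hjm]
      refine hM j ?_
      have : (j : ℕ) ≠ n := fun h => hjm (Fin.ext h)
      omega

/-- The vectors supported on the coordinates of level at most `v`. -/
def levelSubmodule (K : Type*) [Field K] {n : Type*} (b : n → ℕ) (v : ℕ) :
    Submodule K (n → K) where
  carrier := {x | ∀ k, v < b k → x k = 0}
  add_mem' hx hy k hk := by simp [hx k hk, hy k hk]
  zero_mem' _ _ := rfl
  smul_mem' a x hx k hk := by simp [hx k hk]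

/-- Bruhat decomposition with respect to a level function `b` on the columns. -/
theorem exists_bruhat_of_level {K : Type*} [Field K] {r : ℕ} (b : Fin r → ℕ)
    (g : Matrix (Fin r) (Fin r) K) (hg : g.det ≠ 0) :
    ∃ (σ : Equiv.Perm (Fin r)) (L M : Matrix (Fin r) (Fin r) K),
      (∀ j, L j j = 1) ∧ (∀ j k, j ≠ k → ¬(k < j ∧ b (σ j) < b (σ k)) → L j k = 0) ∧
      (∀ j k, b (σ j) < b k → M j k = 0) ∧ g = L * M := by
  classical
  have hli : LinearIndependent K g :=
    Matrix.linearIndependent_rows_iff_isUnit.mpr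
      ((Matrix.isUnit_iff_isUnit_det g).mpr hg.isUnit)
  have hex : ∀ j, ∃ v, ∃ x ∈ levelSubmodule K b v,
      g j - x ∈ Submodule.span K (g '' Set.Iio j) := fun j =>
    ⟨Finset.univ.sup b, g j, fun k hk =>
      absurd (Finset.le_sup (f := b) (Finset.mem_univ k)) (not_le.mpr hk), by simp⟩
  let c : Fin r → ℕ := fun j => Nat.find (hex j)
  have hmono : Monotone (levelSubmodule K b) := fun v w hvw x hx k hk =>
    hx k (hvw.trans_lt hk)
  obtain ⟨M, hM⟩ := exists_reduced_family (levelSubmodule K b) hmono g c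
    fun j => Nat.find_spec (hex j)
  have hmem : ∀ j k, k < j → M k ∈ Submodule.span K (g '' Set.Iio j) := by
    suffices H : ∀ k j, k < j → M k ∈ Submodule.span K (g '' Set.Iio j) from
      fun j k => H k j
    intro k
    induction k using WellFoundedLT.induction with
    | ind k ih =>
      intro j hkj
      rw [← sub_sub_cancel (g k) (M k)]
      refine sub_mem (Submodule.subset_span ⟨k, hkj, rfl⟩) ?_
      refine Submodule.span_le.mpr ?_ (hM k).2
      rintro _ ⟨l, ⟨hl, -⟩, rfl⟩
      exact ih l hl j (hl.trans hkj)
  have hsub : ∀ j, g j - M j ∈ Submodule.span K (g '' Set.Iio j) := by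
    intro j
    refine Submodule.span_le.mpr ?_ (hM j).2
    rintro _ ⟨l, ⟨hl, -⟩, rfl⟩
    exact hmem j l hl
  -- No vector congruent to `g j` modulo its predecessors lives strictly below level `c j`.
  have hmin : ∀ j (x : Fin r → K), (∀ k, c j ≤ b k → x k = 0) →
      g j - x ∉ Submodule.span K (g '' Set.Iio j) := by
    intro j x hx hgx
    rcases hv : c j with _ | w
    · have hx0 : x = 0 := funext fun k => hx k (by omega)
      rw [hx0, sub_zero] at hgx
      exact hli.notMem_span_image (s := Set.Iio j) (x := j) (by simp) hgx
    · exact Nat.find_min (hex j) (m := w) (by change w < c j; omega)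
        ⟨x, fun k hk => hx k (by omega), hgx⟩
  have hdet : (Matrix.of fun j k => if b k = c j then M j k else 0 :
      Matrix (Fin r) (Fin r) K).det ≠ 0 := by
    intro h0
    obtain ⟨a, ha, haM⟩ := Matrix.exists_vecMul_eq_zero_iff.mpr h0
    obtain ⟨j₀, hj₀⟩ := Function.ne_iff.mp ha
    obtain ⟨j, hj, hjmax⟩ := Finset.exists_max_image
      (Finset.univ.filter fun j => a j ≠ 0) id ⟨j₀, by simpa using hj₀⟩
    have haj : a j ≠ 0 := by simpa using hj
    have hlarge : ∀ k, j < k → a k = 0 := fun k hk => by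
      by_contra hak
      exact absurd (hjmax k (by simpa using hak)) (not_le.mpr hk)
    let S := Finset.univ.filter fun k => c k = c j
    refine hmin j (∑ k ∈ S, ((a j)⁻¹ * a k) • M k) ?_ ?_
    · intro l hl
      rw [Finset.sum_apply]
      rcases hl.lt_or_eq with hl | hl
      · refine Finset.sum_eq_zero fun k hk => ?_
        have hk' : c k = c j := by simpa [S] using hk
        rw [Pi.smul_apply, (hM k).1 l (hk' ▸ hl), smul_zero]
      · have h1 := congrFun haM l
        simp only [Matrix.vecMul, dotProduct, Matrix.of_apply, Pi.zero_apply, mul_ite,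
          mul_zero] at h1
        rw [← Finset.sum_filter] at h1
        simp only [Pi.smul_apply, smul_eq_mul, mul_assoc]
        rw [← Finset.mul_sum]
        have hS : S = Finset.univ.filter fun k => b l = c k := by
          ext k
          simp only [S, Finset.mem_filter, Finset.mem_univ, true_and, ← hl, eq_comm]
        rw [hS, h1, mul_zero]
    · have hjS : j ∈ S := by simp [S]
      rw [← Finset.add_sum_erase _ _ hjS, inv_mul_cancel₀ haj, one_smul, ← sub_sub]
      refine sub_mem (hsub j) (Submodule.sum_mem _ fun k hk => ?_)
      rcases lt_or_gt_of_ne (Finset.ne_of_mem_erase hk) with hkj | hkj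
      · exact Submodule.smul_mem _ _ (hmem j k hkj)
      · simp [hlarge k hkj]
  obtain ⟨σ, hσ⟩ := exists_perm_forall_ne_zero _ hdet
  have hbc : ∀ j, b (σ j) = c j := fun j => by
    by_contra hne
    exact hσ j (by simp [hne])
  have hcoef : ∀ j, ∃ a : Fin r → K, (∀ k, ¬(k < j ∧ c j < c k) → a k = 0) ∧
      ∑ k, a k • M k = g j - M j := by
    intro j
    obtain ⟨a, ha, hsum⟩ := (Finsupp.mem_span_image_iff_linearCombination K).mp (hM j).2
    refine ⟨a, fun k hk => ?_, ?_⟩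
    · by_contra hne
      exact hk (ha (Finsupp.mem_support_iff.mpr hne))
    · rw [← hsum, Finsupp.linearCombination_apply, Finsupp.sum_fintype _ _ (by simp)]
  choose a ha hsum using hcoef
  refine ⟨σ, 1 + Matrix.of a, Matrix.of M, fun j => ?_, fun j k hjk hk => ?_,
    fun j k hk => (hM j).1 k (hbc j ▸ hk), ?_⟩
  · simp [ha j j (by simp)]
  · simp only [hbc] at hk
    simp [hjk, ha j k hk]
  · ext j k
    have := congrFun (hsum j) k
    simp only [Finset.sum_apply, Pi.smul_apply, smul_eq_mul, Pi.sub_apply] at this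
    rw [add_mul, one_mul, Matrix.add_apply, Matrix.mul_apply]
    simp only [Matrix.of_apply]
    rw [this]
    ring

/-- Every matrix `g ∈ GL(r,ℂ)` admits a factorization `g = L·Π_σ·P` with
`σ ∈ S_r`, `L ∈ N^c_{λ,σ}`, and `P ∈ P_λ`. -/
theorem bruhat_existence (r s : ℕ) (i : ℕ → ℕ) (hr : 2 ≤ r)
    (hpos : ∀ l < s, 0 < i l) (hsum : psum i s = r)
    (g : Matrix (Fin r) (Fin r) ℂ) (hg : IsUnit g) :
    ∃ (σ : Equiv.Perm (Fin r)) (L P : Matrix (Fin r) (Fin r) ℂ),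
      L ∈ Nc r s i ⇑σ ∧ P ∈ Plam r s i ∧ g = L * permMat r ⇑σ * P := by
  have hdet : g.det ≠ 0 := ((Matrix.isUnit_iff_isUnit_det g).mp hg).ne_zero
  obtain ⟨σ, L, M, hL1, hL, hM, hLM⟩ :=
    exists_bruhat_of_level (fun j : Fin r => blk s i j) g hdet
  have hfac : g = L * permMat r σ * M.submatrix σ.symm id := by
    rw [hLM, mul_assoc]
    congr 1
    ext j k
    simp [permMat, Matrix.mul_apply]
  refine ⟨σ, L, M.submatrix σ.symm id, ⟨⟨hL1, fun j k hjk => ?_⟩, fun j k hkj hb => ?_⟩,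
    ⟨?_, fun j k hjk => ?_⟩, hfac⟩
  · exact hL j k (Fin.ne_of_lt hjk) fun h => lt_asymm h.1 hjk
  · exact hL j k (Fin.ne_of_gt hkj) fun h => not_lt.mpr hb h.2
  · rw [Matrix.isUnit_iff_isUnit_det, isUnit_iff_ne_zero]
    intro h0
    exact hdet (by rw [hfac, Matrix.det_mul, h0, mul_zero])
  · exact hM (σ.symm j) k (by simpa using hjk)
end

section
/- If a matrix g ∈ GL(r,ℂ) admits two factorizations g = L·Π_σ·P = L'·Π_{σ'}·P' with L, L' ∈ N(r), P, P' ∈ P_λ, and σ, σ' ∈ S_r, then there exists π ∈ W_λ with σ' = π∘σ; i.e., the class of the permutation appearing in such a factorization is uniquely determined modulo W_λ. -/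
open Finset Matrix

/-- A function on a finite type that increases pointwise along a comparison of two permutations
takes the same values along both. -/
theorem comp_perm_eq_of_le {ι : Type*} [Fintype ι] (b : ι → ℕ) (σ τ : Equiv.Perm ι)
    (h : ∀ j, b (σ j) ≤ b (τ j)) (j : ι) : b (σ j) = b (τ j) := by
  have hs : ∑ j, b (σ j) = ∑ j, b (τ j) := by
    rw [Equiv.sum_comp σ b, Equiv.sum_comp τ b]
  exact (Finset.sum_eq_sum_iff_of_le fun j _ => h j).1 hs j (Finset.mem_univ j)

theorem permMat_mul_apply {r : ℕ} (σ : Fin r → Fin r) (M : Matrix (Fin r) (Fin r) ℂ)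
    (j k : Fin r) : (permMat r σ * M) j k = M (σ j) k := by
  simp [permMat, Matrix.mul_apply]

theorem mul_permMat_apply {r : ℕ} (σ : Equiv.Perm (Fin r)) (M : Matrix (Fin r) (Fin r) ℂ)
    (j k : Fin r) : (M * permMat r σ) j (σ k) = M j k := by
  simp [permMat, Matrix.mul_apply]

theorem NN.blockTriangular {r : ℕ} {L : Matrix (Fin r) (Fin r) ℂ} (hL : L ∈ NN r) :
    L.BlockTriangular OrderDual.toDual :=
  fun j k h => hL.2 j k h

theorem NN.isUnit_det {r : ℕ} {L : Matrix (Fin r) (Fin r) ℂ} (hL : L ∈ NN r) :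
    IsUnit L.det := by
  simp [Matrix.det_of_isLowerTriangular L (NN.blockTriangular hL), hL.1]

theorem Plam.blockTriangular {r s : ℕ} {i : ℕ → ℕ} {P : Matrix (Fin r) (Fin r) ℂ}
    (hP : P ∈ Plam r s i) :
    P.BlockTriangular fun j : Fin r => OrderDual.toDual (blk s i j) :=
  fun j k h => hP.2 j k h

/-- An invertible lower triangular matrix over a field has nonzero diagonal entries. -/
theorem diag_ne_zero_of_lowerTriangular {ι K : Type*} [Fintype ι] [LinearOrder ι] [Field K]
    {U : Matrix ι ι K} (hU : U.BlockTriangular OrderDual.toDual) (hdet : IsUnit U.det) (j : ι) :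
    U j j ≠ 0 := by
  have h := hdet.ne_zero
  rw [Matrix.det_of_isLowerTriangular U hU, Finset.prod_ne_zero_iff] at h
  exact h j (Finset.mem_univ j)

/-- Permutations occurring in two factorizations of the same matrix have pointwise comparable
block indices. -/
theorem blk_le_blk_of_factorizations {r s : ℕ} {i : ℕ → ℕ} (σ σ' : Equiv.Perm (Fin r))
    {L L' P P' : Matrix (Fin r) (Fin r) ℂ}
    (hL : L ∈ NN r) (hL' : L' ∈ NN r) (hP : P ∈ Plam r s i) (hP' : P' ∈ Plam r s i)
    (heq : L * permMat r ⇑σ * P = L' * permMat r ⇑σ' * P') (j : Fin r) :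
    blk s i (σ j) ≤ blk s i (σ' j) := by
  have hPdet : IsUnit P.det := (Matrix.isUnit_iff_isUnit_det P).1 hP.1
  let := Matrix.invertibleOfIsUnitDet L' (NN.isUnit_det hL')
  let := Matrix.invertibleOfIsUnitDet P hPdet
  have hU : (L'⁻¹ * L).BlockTriangular OrderDual.toDual :=
    (Matrix.blockTriangular_inv_of_blockTriangular (NN.blockTriangular hL')).mul
      (NN.blockTriangular hL)
  have hUdet : IsUnit (L'⁻¹ * L).det := by
    rw [Matrix.det_mul]
    exact (Matrix.isUnit_nonsing_inv_det _ (NN.isUnit_det hL')).mul (NN.isUnit_det hL)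
  have hQ := (Plam.blockTriangular hP').mul
    (Matrix.blockTriangular_inv_of_blockTriangular (Plam.blockTriangular hP))
  have key : L'⁻¹ * L * permMat r σ = permMat r σ' * (P' * P⁻¹) := by
    calc L'⁻¹ * L * permMat r σ = L'⁻¹ * (L * permMat r σ * P) * P⁻¹ := by
          simp [Matrix.mul_assoc]
      _ = permMat r σ' * (P' * P⁻¹) := by
          rw [heq]; simp [Matrix.mul_assoc]
  have hentry := congrFun (congrFun key j) (σ j)
  rw [mul_permMat_apply, permMat_mul_apply] at hentry
  by_contra! hlt
  exact diag_ne_zero_of_lowerTriangular hU hUdet j (hentry.trans (hQ hlt))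

/-- If a matrix `g ∈ GL(r,ℂ)` admits two factorizations
`g = L·Π_σ·P = L'·Π_{σ'}·P'` with `L, L' ∈ N(r)`, `P, P' ∈ P_λ`, `σ, σ' ∈ S_r`, then there
exists `π ∈ W_λ` with `σ' = π∘σ`: the class of the permutation appearing in such a
factorization is uniquely determined modulo `W_λ`. -/
theorem bruhat_coset_uniqueness (r s : ℕ) (i : ℕ → ℕ) (hr : 2 ≤ r)
    (hpos : ∀ l < s, 0 < i l) (hsum : psum i s = r)
    (σ σ' : Equiv.Perm (Fin r)) (L L' P P' : Matrix (Fin r) (Fin r) ℂ)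
    (hL : L ∈ NN r) (hL' : L' ∈ NN r) (hP : P ∈ Plam r s i) (hP' : P' ∈ Plam r s i)
    (heq : L * permMat r ⇑σ * P = L' * permMat r ⇑σ' * P') :
    ∃ π : Equiv.Perm (Fin r), (∀ j : Fin r, blk s i (π j) = blk s i j) ∧ σ' = π * σ := by
  have hblk := comp_perm_eq_of_le (fun j : Fin r => blk s i j) σ σ'
    (blk_le_blk_of_factorizations σ σ' hL hL' hP hP' heq)
  refine ⟨σ' * σ⁻¹, fun j => ?_, by simp⟩
  simpa using (hblk (σ⁻¹ j)).symm
end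

section
/- Fix a permutation σ ∈ S_r. If L·Π_σ·P = L'·Π_σ·P' with L, L' ∈ N^c_{λ,σ} and P, P' ∈ P_λ, then L = L' and P = P'. Equivalently, the map from N^c_{λ,σ} to the left-coset space GL(r,ℂ)/P_λ sending L to the coset (L·Π_σ)·P_λ is injective; together with existence of Bruhat factorizations this exhibits the Bruhat cell as a torsor for the group N^c_{λ,σ}. -/
open Finset Matrix

theorem mem_Plam_iff {r s : ℕ} {i : ℕ → ℕ} {g : Matrix (Fin r) (Fin r) ℂ} :
    g ∈ Plam r s i ↔
      IsUnit g ∧ g.BlockTriangular fun j : Fin r => OrderDual.toDual (blk s i j) :=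
  Iff.rfl

theorem mul_inv_mem_Plam {r s : ℕ} {i : ℕ → ℕ} {P P' : Matrix (Fin r) (Fin r) ℂ}
    (hP : P ∈ Plam r s i) (hP' : P' ∈ Plam r s i) : P * P'⁻¹ ∈ Plam r s i := by
  rw [mem_Plam_iff] at *
  have := hP'.1.invertible
  exact ⟨hP.1.mul (isUnit_of_invertible P'⁻¹),
    hP.2.mul (blockTriangular_inv_of_blockTriangular hP'.2)⟩

/-- The off-diagonal support of an element of `N^c_{λ,σ}`. -/
theorem Nc_apply_eq_zero {r s : ℕ} {i : ℕ → ℕ} {σ : Fin r → Fin r}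
    {U : Matrix (Fin r) (Fin r) ℂ} (hU : U ∈ Nc r s i σ) {j k : Fin r} (hjk : j ≠ k)
    (h : ¬ (k < j ∧ blk s i (σ j) < blk s i (σ k))) : U j k = 0 := by
  rcases lt_or_gt_of_ne hjk with hlt | hgt
  · exact hU.1.2 j k hlt
  · exact hU.2 j k hgt (not_lt.mp fun hc => h ⟨hgt, hc⟩)

/-- If `L * Q = L'` with `L, L' ∈ N^c_{λ,σ}` and `Q` in the conjugate of `P_λ` by `σ`,
then `Q = 1`. -/
theorem eq_one_of_Nc_mul_eq {r s : ℕ} {i : ℕ → ℕ} {σ : Fin r → Fin r}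
    {L L' Q : Matrix (Fin r) (Fin r) ℂ} (hL : L ∈ Nc r s i σ) (hL' : L' ∈ Nc r s i σ)
    (hQ : ∀ j k, blk s i (σ j) < blk s i (σ k) → Q j k = 0) (h : L * Q = L') : Q = 1 := by
  have hR : L * (Q - 1) = L' - L := by rw [mul_sub, h, mul_one]
  have key : ∀ j k, (Q - 1) j k = 0 := by
    intro j
    induction j using WellFoundedLT.induction with
    | ind j ih =>
      intro k
      by_cases hc : blk s i (σ j) < blk s i (σ k)
      · have hjk : j ≠ k := by rintro rfl; exact lt_irrefl _ hc
        simp [hQ j k hc, hjk]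
      · have hrow : (L * (Q - 1)) j k = (Q - 1) j k := by
          rw [Matrix.mul_apply, Finset.sum_eq_single j, hL.1.1 j, one_mul]
          · intro m _ hm
            rcases lt_or_gt_of_ne hm with hlt | hgt
            · rw [ih m hlt k, mul_zero]
            · rw [hL.1.2 j m hgt, zero_mul]
          · simp
        rw [← hrow, hR, Matrix.sub_apply]
        rcases eq_or_ne j k with rfl | hjk
        · rw [hL.1.1, hL'.1.1, sub_self]
        · rw [Nc_apply_eq_zero hL hjk fun h => hc h.2,
            Nc_apply_eq_zero hL' hjk fun h => hc h.2, sub_self]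
  exact sub_eq_zero.mp (Matrix.ext key)

/-- Fix a permutation `σ ∈ S_r`. If `L·Π_σ·P = L'·Π_σ·P'` with
`L, L' ∈ N^c_{λ,σ}` and `P, P' ∈ P_λ`, then `L = L'` and `P = P'` (uniqueness of the
generalized Bruhat factorization for fixed `σ`; this exhibits the Bruhat cell as a torsor
for the group `N^c_{λ,σ}`). -/
theorem bruhat_strict_uniqueness (r s : ℕ) (i : ℕ → ℕ) (hr : 2 ≤ r)
    (hpos : ∀ l < s, 0 < i l) (hsum : psum i s = r)
    (σ : Equiv.Perm (Fin r)) (L L' P P' : Matrix (Fin r) (Fin r) ℂ)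
    (hL : L ∈ Nc r s i ⇑σ) (hL' : L' ∈ Nc r s i ⇑σ)
    (hP : P ∈ Plam r s i) (hP' : P' ∈ Plam r s i)
    (heq : L * permMat r ⇑σ * P = L' * permMat r ⇑σ * P') :
    L = L' ∧ P = P' := by
  have hdet : IsUnit P'.det := (Matrix.isUnit_iff_isUnit_det P').mp hP'.1
  have hQ := mul_inv_mem_Plam hP hP'
  have hcancel : L * (permMat r σ * (P * P'⁻¹)) = L' * permMat r σ := by
    rw [← Matrix.mul_assoc, ← Matrix.mul_assoc, heq, Matrix.mul_nonsing_inv_cancel_right _ _ hdet]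
  have hconj : L * (P * P'⁻¹).submatrix σ σ = L' := by
    ext j k
    rw [← mul_permMat_apply σ L' j k, ← hcancel, Matrix.mul_apply, Matrix.mul_apply]
    exact Finset.sum_congr rfl fun m _ => by rw [permMat_mul_apply, Matrix.submatrix_apply]
  have hone : (P * P'⁻¹).submatrix σ σ = 1 :=
    eq_one_of_Nc_mul_eq hL hL' (fun j k hjk => hQ.2 (σ j) (σ k) hjk) hconj
  refine ⟨by rw [← hconj, hone, mul_one], ?_⟩
  have hPP : P * P'⁻¹ = 1 := by
    ext j k
    simpa [Matrix.one_apply] using congrFun (congrFun hone (σ.symm j)) (σ.symm k)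
  rw [← Matrix.nonsing_inv_mul_cancel_right P' P hdet, hPP, one_mul]
end

section
/- For each 1 ≤ l ≤ s−1, the group N^c_{λ_l,ρ_l} (formed with respect to the cyclically shifted partition λ_l and the cyclic-shift permutation ρ_l) equals the single-block unipotent group U_l = {U ∈ N(r) : U_{jk} = 0 for all j > k except possibly when j > a_l ≥ k}, and this group is abelian. -/
open Finset Matrix

theorem blk_mono (s : ℕ) (i : ℕ → ℕ) : Monotone (blk s i) := fun _ _ h =>
  Finset.card_le_card <| Finset.monotone_filter_right _ fun _ _ ht => ht.trans h

theorem blk_lt_blk_of_psum_between {s t x y : ℕ} {i : ℕ → ℕ} (ht : t < s)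
    (hx : x < psum i (t + 1)) (hy : psum i (t + 1) ≤ y) : blk s i x < blk s i y := by
  refine Finset.card_lt_card <| (Finset.ssubset_iff_of_subset ?_).2 ⟨t, ?_, ?_⟩
  · exact Finset.monotone_filter_right _ fun _ _ h => h.trans (hx.le.trans hy)
  · simp [ht, hy]
  · simp [hx]

theorem Ublock_sub_one_apply_eq_zero {r a : ℕ} {U : Matrix (Fin r) (Fin r) ℂ}
    (hU : U ∈ Ublock r a) {j k : Fin r} (h : ¬(a ≤ (j : ℕ) ∧ (k : ℕ) < a)) :
    (U - 1) j k = 0 := by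
  obtain ⟨⟨hd, hu⟩, hl⟩ := hU
  rcases lt_trichotomy j k with hjk | rfl | hjk
  · simp [hu j k hjk, hjk.ne]
  · simp [hd]
  · simp [hl j k hjk h, hjk.ne']

theorem Ublock_sub_one_mul_sub_one {r a : ℕ} {U V : Matrix (Fin r) (Fin r) ℂ}
    (hU : U ∈ Ublock r a) (hV : V ∈ Ublock r a) : (U - 1) * (V - 1) = 0 := by
  ext j k
  rw [Matrix.mul_apply, Matrix.zero_apply]
  refine Finset.sum_eq_zero fun m _ => ?_
  by_cases hm : (m : ℕ) < a
  · rw [Ublock_sub_one_apply_eq_zero hV (by omega), mul_zero]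
  · rw [Ublock_sub_one_apply_eq_zero hU (by omega), zero_mul]

theorem Ublock_mul_comm {r a : ℕ} {U V : Matrix (Fin r) (Fin r) ℂ}
    (hU : U ∈ Ublock r a) (hV : V ∈ Ublock r a) : U * V = V * U := by
  have h : (U - 1) * (V - 1) = (V - 1) * (U - 1) := by
    rw [Ublock_sub_one_mul_sub_one hU hV, Ublock_sub_one_mul_sub_one hV hU]
  have h' : U * V - V * U = (U - 1) * (V - 1) - (V - 1) * (U - 1) := by noncomm_ring
  rwa [h, sub_self, sub_eq_zero] at h'

/-- For each `1 ≤ l ≤ s−1`, the group `N^c_{λ_l,ρ_l}` (formed with respect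
to the cyclically shifted partition `λ_l = (i_{l+1},…,i_s,i_1,…,i_l)` and the cyclic-shift
permutation `ρ_l`) equals the single-block unipotent group
`U_l = {U ∈ N(r) : U_{jk} = 0 for all j > k except possibly when j > a_l ≥ k}`, and this
group is abelian. (Here `a_l = i_1 + ⋯ + i_l`; all positions are 0-indexed in the
formalization.) -/
theorem Nc_shifted_eq_single_block (r s : ℕ) (i : ℕ → ℕ) (hr : 2 ≤ r) (hs : 2 ≤ s)
    (hpos : ∀ l' < s, 0 < i l') (hsum : psum i s = r)
    (l : ℕ) (hl1 : 1 ≤ l) (hl2 : l ≤ s - 1)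
    (i' : ℕ → ℕ)
    (hi' : ∀ t < s, i' t = if t < s - l then i (t + l) else i (t - (s - l)))
    (ρ : Equiv.Perm (Fin r))
    (hρ : ∀ k : Fin r, ((ρ k : ℕ)) =
      if (k : ℕ) < psum i l then (k : ℕ) + r - psum i l else (k : ℕ) - psum i l) :
    Nc r s i' ⇑ρ = Ublock r (psum i l) ∧
    ∀ U ∈ Ublock r (psum i l), ∀ V ∈ Ublock r (psum i l), U * V = V * U := by
  have hadd : psum i l + psum i' (s - l) = r := by
    rw [← hsum, show s = l + (s - l) by omega, psum, psum, psum, Finset.sum_range_add,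
      Nat.add_sub_cancel_left]
    congr 1
    refine Finset.sum_congr rfl fun t ht => ?_
    have ht' := Finset.mem_range.1 ht
    rw [hi' t (by omega), if_pos ht', add_comm]
  have key (j k : Fin r) (hkj : (k : ℕ) < j) :
      blk s i' (ρ k) ≤ blk s i' (ρ j) ↔ ¬(psum i l ≤ (j : ℕ) ∧ (k : ℕ) < psum i l) := by
    have hj := hρ j
    have hk := hρ k
    have hjr := j.isLt
    constructor
    · rintro hle ⟨haj, hka⟩
      rw [if_neg (by omega)] at hj
      rw [if_pos hka] at hk
      have hs' : s - l - 1 + 1 = s - l := by omega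
      refine hle.not_gt (blk_lt_blk_of_psum_between (t := s - l - 1) (by omega) ?_ ?_) <;>
        rw [hs'] <;> omega
    · intro h
      apply blk_mono
      split_ifs at hj hk <;> omega
  refine ⟨?_, fun U hU V hV => Ublock_mul_comm hU hV⟩
  ext U
  refine and_congr_right fun _ => forall₂_congr fun j k => forall_congr' fun hkj => ?_
  rw [key j k hkj]
end

section
/- For 1 ≤ l_1, l_2 ≤ s−1 with l_1 ≠ l_2, the commutator subgroup of the single-block unipotent subgroups U_{l_1} and U_{l_2} equals their intersection: ⁅U_{l_1}, U_{l_2}⁆ = U_{l_1} ∩ U_{l_2} as subgroups of GL(r,ℂ). -/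
open Finset Matrix

/-- `Z` is supported on the lower-left block of rows `≥ q` and columns `< p`. -/
def BlockSupported {r : ℕ} (p q : ℕ) (Z : Matrix (Fin r) (Fin r) ℂ) : Prop :=
  ∀ j k : Fin r, ¬(q ≤ (j : ℕ) ∧ (k : ℕ) < p) → Z j k = 0

namespace BlockSupported

variable {r p q p' q' : ℕ} {A B : Matrix (Fin r) (Fin r) ℂ}

theorem mono (hA : BlockSupported p q A) (hp : p ≤ p') (hq : q' ≤ q) :
    BlockSupported p' q' A :=
  fun j k h => hA j k fun hjk => h ⟨hq.trans hjk.1, hjk.2.trans_le hp⟩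

theorem zero : BlockSupported p q (0 : Matrix (Fin r) (Fin r) ℂ) := fun _ _ _ => rfl

theorem add (hA : BlockSupported p q A) (hB : BlockSupported p q B) :
    BlockSupported p q (A + B) := fun j k h => by
  simp [hA j k h, hB j k h]

theorem neg (hA : BlockSupported p q A) : BlockSupported p q (-A) := fun j k h => by
  simp [hA j k h]

theorem mul (hA : BlockSupported p q A) (hB : BlockSupported p' q' B) :
    BlockSupported p' q (A * B) := fun j k h => by
  rw [Matrix.mul_apply]
  refine Finset.sum_eq_zero fun m _ => ?_
  by_cases hj : q ≤ (j : ℕ)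
  · rw [hB m k fun hmk => h ⟨hj, hmk.2⟩, mul_zero]
  · rw [hA j m fun hjm => hj hjm.1, zero_mul]

theorem mul_eq_zero (hA : BlockSupported p q A) (hB : BlockSupported p' q' B) (h : p ≤ q') :
    A * B = 0 := by
  ext j k
  rw [Matrix.mul_apply]
  refine Finset.sum_eq_zero fun m _ => ?_
  by_cases hm : (m : ℕ) < p
  · rw [hB m k fun hmk => by omega, mul_zero]
  · rw [hA j m fun hjm => hm hjm.2, zero_mul]

theorem single {j k : Fin r} (hj : q ≤ (j : ℕ)) (hk : (k : ℕ) < p) (c : ℂ) :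
    BlockSupported p q (Matrix.single j k c) := fun j' k' h => by
  apply Matrix.single_apply_of_ne
  rintro ⟨rfl, rfl⟩
  exact h ⟨hj, hk⟩

theorem inter (hA : BlockSupported p q A) (hA' : BlockSupported p' q' A) :
    BlockSupported p q' A := fun j k h => by
  by_cases hk : q ≤ (j : ℕ) ∧ (k : ℕ) < p
  · exact hA' j k fun hjk => h ⟨hjk.1, hk.2⟩
  · exact hA j k hk

end BlockSupported

theorem mem_Ublock_iff {r a : ℕ} {U : Matrix (Fin r) (Fin r) ℂ} :
    U ∈ Ublock r a ↔ BlockSupported a a (U - 1) := by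
  constructor
  · rintro ⟨⟨hd, hu⟩, hl⟩ j k h
    rcases lt_trichotomy (j : ℕ) k with hjk | hjk | hjk
    · simp [hu j k hjk, Fin.ne_of_lt hjk]
    · obtain rfl := Fin.ext hjk
      simp [hd j]
    · simp [hl j k hjk h, Fin.ne_of_gt hjk]
  · intro h
    refine ⟨⟨fun j => ?_, fun j k hjk => ?_⟩, fun j k hjk hb => ?_⟩
    · simpa [sub_eq_zero] using h j j (by omega)
    · simpa [Matrix.one_apply, Fin.ne_of_lt hjk] using h j k (by omega)
    · simpa [Matrix.one_apply, Fin.ne_of_gt hjk] using h j k hb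

theorem one_add_mem_Ublock_iff {r a : ℕ} {Z : Matrix (Fin r) (Fin r) ℂ} :
    1 + Z ∈ Ublock r a ↔ BlockSupported a a Z := by
  rw [mem_Ublock_iff, add_sub_cancel_left]

/-- The unit `1 + X` attached to an element `X` of square zero. -/
def unitOneAdd {R : Type*} [Ring R] (X : R) (hX : X * X = 0) : Rˣ where
  val := 1 + X
  inv := 1 - X
  val_inv := by simp [add_mul, mul_sub, hX]
  inv_val := by simp [sub_mul, mul_add, hX]

open scoped commutatorElement in
theorem val_commutatorElement_of_mul_eq_zero {R : Type*} [Ring R] {g h : Rˣ} {X Y : R}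
    (hg : (g : R) = 1 + X) (hh : (h : R) = 1 + Y) (hXX : X * X = 0)
    (hXY : X * Y = 0) : ((⁅g, h⁆ : Rˣ) : R) = 1 - Y * X := by
  have key : (1 - Y * X) * ((h : R) * g) = g * h := by
    have hYXX : Y * X * X = 0 := by rw [mul_assoc, hXX, mul_zero]
    have hYXY : Y * X * Y = 0 := by rw [mul_assoc, hXY, mul_zero]
    have e : (1 - Y * X) * ((1 + Y) * (1 + X)) =
        1 + X + Y - Y * X * X - Y * X * Y - Y * X * Y * X := by noncomm_ring
    rw [hg, hh, e, hYXX, hYXY, add_mul, mul_add, mul_add, hXY]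
    simp
    abel
  have hc : ⁅g, h⁆ = g * h * (h * g)⁻¹ := by
    rw [commutatorElement_def]
    group
  rw [hc, Units.val_mul, Units.mul_inv_eq_iff_eq_mul, Units.val_mul, Units.val_mul, key]

open scoped commutatorElement in
/-- The commutator of the unipotent block subgroups at cut points `a < b`. -/
theorem commutator_eq_inf_of_mem_iff_mem_Ublock {r a b : ℕ} (hab : a < b) (hbr : b < r)
    {H K : Subgroup (GL (Fin r) ℂ)}
    (hH : ∀ g : GL (Fin r) ℂ, g ∈ H ↔ (g : Matrix (Fin r) (Fin r) ℂ) ∈ Ublock r a)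
    (hK : ∀ g : GL (Fin r) ℂ, g ∈ K ↔ (g : Matrix (Fin r) (Fin r) ℂ) ∈ Ublock r b) :
    ⁅H, K⁆ = H ⊓ K := by
  apply le_antisymm
  · rw [Subgroup.commutator_le]
    intro g hg h hh
    have hX := mem_Ublock_iff.1 ((hH g).1 hg)
    have hY := mem_Ublock_iff.1 ((hK h).1 hh)
    have hc := val_commutatorElement_of_mul_eq_zero (g := g) (h := h)
      (add_sub_cancel 1 _).symm (add_sub_cancel 1 _).symm (hX.mul_eq_zero hX le_rfl)
      (hX.mul_eq_zero hY hab.le)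
    have hYX := (hY.mul hX).neg
    rw [sub_eq_add_neg] at hc
    rw [Subgroup.mem_inf, hH, hK, hc, one_add_mem_Ublock_iff, one_add_mem_Ublock_iff]
    exact ⟨hYX.mono le_rfl hab.le, hYX.mono hab.le le_rfl⟩
  · have hsingle (j k : Fin r) (hj : b ≤ (j : ℕ)) (hk : (k : ℕ) < a) (c : ℂ) :
        ∃ h ∈ ⁅H, K⁆, (h : Matrix (Fin r) (Fin r) ℂ) = 1 + Matrix.single j k c := by
      let m : Fin r := ⟨a, hab.trans hbr⟩
      have hX : BlockSupported a a (Matrix.single m k (1 : ℂ)) := .single (le_refl a) hk 1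
      have hY : BlockSupported b b (Matrix.single j m (-c)) := .single hj hab (-c)
      have hXX := hX.mul_eq_zero hX le_rfl
      have hYY := hY.mul_eq_zero hY le_rfl
      refine ⟨⁅unitOneAdd _ hXX, unitOneAdd _ hYY⁆, Subgroup.commutator_mem_commutator
        ((hH _).2 (one_add_mem_Ublock_iff.2 hX)) ((hK _).2 (one_add_mem_Ublock_iff.2 hY)), ?_⟩
      rw [val_commutatorElement_of_mul_eq_zero rfl rfl hXX (hX.mul_eq_zero hY hab.le),
        Matrix.single_mul_single_same, mul_one, sub_eq_add_neg, ← Matrix.single_neg, neg_neg]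
    intro g hg
    obtain ⟨hgH, hgK⟩ := Subgroup.mem_inf.1 hg
    have hZ := (mem_Ublock_iff.1 ((hH g).1 hgH)).inter
      (mem_Ublock_iff.1 ((hK g).1 hgK))
    let Q (Z : Matrix (Fin r) (Fin r) ℂ) : Prop := BlockSupported a b Z ∧
      ∃ h ∈ ⁅H, K⁆, (h : Matrix (Fin r) (Fin r) ℂ) = 1 + Z
    have hQ0 : Q 0 := ⟨.zero, 1, one_mem _, by simp⟩
    have hQadd (A B) (hA : Q A) (hB : Q B) : Q (A + B) := by
      obtain ⟨hA, u, hu, hu'⟩ := hA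
      obtain ⟨hB, v, hv, hv'⟩ := hB
      refine ⟨hA.add hB, u * v, mul_mem hu hv, ?_⟩
      rw [Units.val_mul, hu', hv', add_mul, mul_add, mul_add, hA.mul_eq_zero hB hab.le]
      simp
      abel
    have hQ : Q ((g : Matrix (Fin r) (Fin r) ℂ) - 1) := by
      rw [Matrix.matrix_eq_sum_single ((g : Matrix (Fin r) (Fin r) ℂ) - 1)]
      refine Finset.sum_induction _ Q hQadd hQ0 fun j _ =>
        Finset.sum_induction _ Q hQadd hQ0 fun k _ => ?_
      by_cases h : b ≤ (j : ℕ) ∧ (k : ℕ) < a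
      · exact ⟨.single h.1 h.2 _, hsingle j k h.1 h.2 _⟩
      · rw [hZ j k h, Matrix.single_zero]
        exact hQ0
    obtain ⟨-, h, hh, hhg⟩ := hQ
    rw [add_sub_cancel] at hhg
    rwa [← Units.ext hhg]

theorem psum_lt_psum {s : ℕ} {i : ℕ → ℕ} (hpos : ∀ l < s, 0 < i l) {l m : ℕ} (hlm : l < m)
    (hms : m ≤ s) : psum i l < psum i m :=
  Finset.sum_lt_sum_of_subset (Finset.range_subset_range.2 hlm.le) (Finset.mem_range.2 hlm)
    (by simp) (hpos l (by omega)) (by simp)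

/-- For `1 ≤ l₁, l₂ ≤ s−1` with `l₁ ≠ l₂`, the commutator subgroup of the
single-block unipotent subgroups `U_{l₁}` and `U_{l₂}` equals their intersection:
`⁅U_{l₁}, U_{l₂}⁆ = U_{l₁} ∩ U_{l₂}` as subgroups of `GL(r,ℂ)`.
(Here `H₁, H₂` are the subgroups of `GL(r,ℂ)` whose elements are exactly the matrices in
`U_{l₁}` resp. `U_{l₂}`, with `a_l = i_1 + ⋯ + i_l`.) -/
theorem commutator_single_block (r s : ℕ) (i : ℕ → ℕ) (hr : 2 ≤ r) (hs : 3 ≤ s)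
    (hpos : ∀ l' < s, 0 < i l') (hsum : psum i s = r)
    (l₁ l₂ : ℕ) (hl₁ : 1 ≤ l₁ ∧ l₁ ≤ s - 1) (hl₂ : 1 ≤ l₂ ∧ l₂ ≤ s - 1) (hne : l₁ ≠ l₂)
    (H₁ H₂ : Subgroup (GL (Fin r) ℂ))
    (hH₁ : ∀ g : GL (Fin r) ℂ, g ∈ H₁ ↔ (g : Matrix (Fin r) (Fin r) ℂ) ∈ Ublock r (psum i l₁))
    (hH₂ : ∀ g : GL (Fin r) ℂ, g ∈ H₂ ↔ (g : Matrix (Fin r) (Fin r) ℂ) ∈ Ublock r (psum i l₂)) :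
    ⁅H₁, H₂⁆ = H₁ ⊓ H₂ := by
  rcases hne.lt_or_gt with h | h
  · exact commutator_eq_inf_of_mem_iff_mem_Ublock (psum_lt_psum hpos h (by omega))
      (hsum ▸ psum_lt_psum hpos (by omega) le_rfl) hH₁ hH₂
  · rw [Subgroup.commutator_comm, inf_comm]
    exact commutator_eq_inf_of_mem_iff_mem_Ublock (psum_lt_psum hpos h (by omega))
      (hsum ▸ psum_lt_psum hpos (by omega) le_rfl) hH₂ hH₁
end
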